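/- Let k ≥ 2, 1 ≤ l ≤ k−1, and let u(x,t) = u_0(x − t) with u_0 : ℝ → ℝ of class C^{k+l+2}, so that u_t + u_x = 0. Then for every cell τ_j, every t, and every polynomial v of degree ≤ k, a_j(u − u_I^l, v) = (h_j/2)^l G_{l+1}(t) ∫_{τ_j} F_l(x) v(x) dx, where in a_j the trace (u − u_I^l)(x_{j-1/2}^-) is taken from the cell τ_{j−1} for j ≥ 2 (where it equals 0) and is set equal to 0 for j = 1. -/

import Mathlib

open MeasureTheory intervalIntegral

/-- Legendre polynomial of degree `m` via the Rodrigues formula. -/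
noncomputable def legendreP (m : ℕ) : ℝ → ℝ :=
  fun s => (1 / ((2:ℝ) ^ m * (Nat.factorial m : ℝ))) *
    iteratedDeriv m (fun t : ℝ => (t ^ 2 - 1) ^ m) s

/-- Legendre polynomial rescaled to the cell `(a, b)`. -/
noncomputable def legendreCell (m : ℕ) (a b : ℝ) : ℝ → ℝ :=
  fun x => legendreP m ((2 * x - (a + b)) / (b - a))

/-- `P` is the Gauss–Radau projection (onto polynomials of degree ≤ k on `(a,b)`) of `u`. -/
def IsGRProj (k : ℕ) (a b : ℝ) (u : ℝ → ℝ) (P : Polynomial ℝ) : Prop :=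
  P.natDegree ≤ k ∧
  (∀ v : Polynomial ℝ, v.natDegree + 1 ≤ k →
    (∫ x in a..b, P.eval x * v.eval x) = ∫ x in a..b, u x * v.eval x) ∧
  P.eval b = u b

/-- The scaled primitive `(D⁻¹ v)(x) = (2/(b-a)) ∫_a^x v`. -/
noncomputable def Dinv (a b : ℝ) (v : ℝ → ℝ) : ℝ → ℝ :=
  fun x => (2 / (b - a)) * ∫ t in a..x, v t

/-- `F` is the sequence of correction polynomials on the cell `(a,b)`:
`F 1 = P_h^-(D⁻¹ L_k)` and `F i = -P_h^-(D⁻¹ F (i-1))` for `i ≥ 2`. -/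
def IsFSeq (k : ℕ) (a b : ℝ) (F : ℕ → Polynomial ℝ) : Prop :=
  IsGRProj k a b (Dinv a b (legendreCell k a b)) (F 1) ∧
  ∀ i, 2 ≤ i → IsGRProj k a b (Dinv a b (fun x => (F (i-1)).eval x)) (-(F i))

/-- The `m`-th Radau coefficient of `w` on the cell `(a,b)`. -/
noncomputable def radauCoeff (a b : ℝ) (w : ℝ → ℝ) (m : ℕ) : ℝ :=
  w b - (1 / (b - a)) *
    ∫ x in a..b, w x * ∑ l ∈ Finset.range m, (2 * (l:ℝ) + 1) * legendreCell l a b x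

/-- `G_i(t) = (d/dt)^i u_{j,k+1}(t)` for `u(x,t) = u0(x - t)` on the cell `(a,b)`. -/
noncomputable def Gfun (k : ℕ) (a b : ℝ) (u0 : ℝ → ℝ) (i : ℕ) (t : ℝ) : ℝ :=
  iteratedDeriv i (fun s => radauCoeff a b (fun y => u0 (y - s)) (k + 1)) t

/-- `w_i(x,t) = (h_j/2)^i G_i(t) F_i(x)` on the cell `(a,b)`. -/
noncomputable def wFun (k : ℕ) (a b : ℝ) (u0 : ℝ → ℝ) (F : ℕ → Polynomial ℝ)
    (i : ℕ) (y t : ℝ) : ℝ :=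
  ((b - a) / 2) ^ i * Gfun k a b u0 i t * (F i).eval y

/-- `w^l = Σ_{i=1}^l w_i` on the cell `(a,b)`. -/
noncomputable def wSum (k : ℕ) (a b : ℝ) (u0 : ℝ → ℝ) (F : ℕ → Polynomial ℝ)
    (l : ℕ) (y t : ℝ) : ℝ :=
  ∑ i ∈ Finset.Icc 1 l, wFun k a b u0 F i y t

/-- The interpolation function `u_I^l = P_h^- u - w^l` on the cell `(a,b)`;
here `P t` is the Gauss–Radau projection of `u(·,t)`. -/
noncomputable def uIl (k : ℕ) (a b : ℝ) (u0 : ℝ → ℝ) (P : ℝ → Polynomial ℝ)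
    (F : ℕ → Polynomial ℝ) (l : ℕ) (y t : ℝ) : ℝ :=
  (P t).eval y - wSum k a b u0 F l y t

/-- `uh` is a DG solution on `[0,T]` on the mesh `x 0 < x 1 < … < x N`
(the piece on the cell `τ_j = (x (j-1), x j)` is the polynomial `uh j t`),
with prescribed inflow value `inflow t` at the left boundary. -/
def IsDGSol (k N : ℕ) (x : ℕ → ℝ) (T : ℝ) (inflow : ℝ → ℝ)
    (uh : ℕ → ℝ → Polynomial ℝ) : Prop :=
  (∀ j ∈ Finset.Icc 1 N, ∀ t : ℝ, (uh j t).natDegree ≤ k) ∧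
  (∀ j ∈ Finset.Icc 1 N, ∀ y : ℝ, ContDiff ℝ 1 (fun t => (uh j t).eval y)) ∧
  (∀ j ∈ Finset.Icc 1 N, ∀ t ∈ Set.Icc (0:ℝ) T, ∀ v : Polynomial ℝ, v.natDegree ≤ k →
    (∫ y in (x (j-1))..(x j), deriv (fun s => (uh j s).eval y) t * v.eval y)
      - (∫ y in (x (j-1))..(x j), (uh j t).eval y * v.derivative.eval y)
      + (uh j t).eval (x j) * v.eval (x j)
      - (if j = 1 then inflow t else (uh (j-1) t).eval (x (j-1))) * v.eval (x (j-1)) = 0)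

/-- The error `u - u_I^l` on the cell `τ_j`, as a function of `(y, s)`. -/
noncomputable def errFun (k l : ℕ) (x : ℕ → ℝ) (u0 : ℝ → ℝ)
    (P : ℕ → ℝ → Polynomial ℝ) (F : ℕ → ℕ → Polynomial ℝ) (j : ℕ) (y s : ℝ) : ℝ :=
  u0 (y - s) - uIl k (x (j-1)) (x j) u0 (P j) (F j) l y s

section helpers

open Polynomial

/-- Legendre polynomial as a polynomial. -/
noncomputable def LegP (m : ℕ) : ℝ[X] :=
  C (1 / ((2:ℝ) ^ m * (Nat.factorial m : ℝ))) * derivative^[m] ((X ^ 2 - 1) ^ m)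

lemma iteratedDeriv_poly (m : ℕ) (p : ℝ[X]) :
    iteratedDeriv m (fun x => p.eval x) = fun x => (derivative^[m] p).eval x := by
  induction m with
  | zero => simp
  | succ n ih =>
    rw [iteratedDeriv_succ, ih, Function.iterate_succ_apply']
    funext x
    simp

lemma legendreP_eq (m : ℕ) (s : ℝ) : legendreP m s = (LegP m).eval s := by
  have h : (fun t : ℝ => (t ^ 2 - 1) ^ m) = fun t => ((X ^ 2 - 1 : ℝ[X]) ^ m).eval t := by
    funext t; simp
  rw [legendreP, h, iteratedDeriv_poly, LegP, eval_mul, eval_C]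

lemma eval_iter (n m : ℕ) (c : ℝ) (q : ℝ[X]) :
    (derivative^[n] ((X - C c) ^ m * q)).eval c
      = n.factorial * (X ^ m * taylor c q).coeff n := by
  rw [← factorial_smul_hasseDeriv, LinearMap.smul_apply, eval_smul, ← taylor_coeff, taylor_mul]
  have : taylor c ((X - C c) ^ m) = X ^ m := by
    rw [taylor_pow]; simp
  rw [this, nsmul_eq_mul]

lemma fac1 (m : ℕ) : ((X : ℝ[X]) ^ 2 - 1) ^ m = (X - C 1) ^ m * (X + 1) ^ m := by
  rw [← mul_pow]; congr 1; simp; ring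

lemma fac2 (m : ℕ) : ((X : ℝ[X]) ^ 2 - 1) ^ m = (X - C (-1)) ^ m * (X - 1) ^ m := by
  rw [← mul_pow]; congr 1; simp; ring

lemma bd1 {n m : ℕ} (h : n < m) : (derivative^[n] (((X : ℝ[X]) ^ 2 - 1) ^ m)).eval 1 = 0 := by
  rw [fac1, eval_iter, coeff_X_pow_mul', if_neg (by omega), mul_zero]

lemma bd2 {n m : ℕ} (h : n < m) : (derivative^[n] (((X : ℝ[X]) ^ 2 - 1) ^ m)).eval (-1) = 0 := by
  rw [fac2, eval_iter, coeff_X_pow_mul', if_neg (by omega), mul_zero]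

lemma Lp_one (m : ℕ) : (LegP m).eval 1 = 1 := by
  rw [LegP, fac1, eval_mul, eval_iter, coeff_X_pow_mul', if_pos le_rfl, Nat.sub_self,
    taylor_coeff_zero, eval_C]
  have : (m.factorial : ℝ) ≠ 0 := by exact_mod_cast m.factorial_ne_zero
  simp
  field_simp
  norm_num

lemma Lp_neg_one (m : ℕ) : (LegP m).eval (-1) ^ 2 = 1 := by
  rw [LegP, fac2, eval_mul, eval_iter, coeff_X_pow_mul', if_pos le_rfl, Nat.sub_self,
    taylor_coeff_zero, eval_C]
  have : (m.factorial : ℝ) ≠ 0 := by exact_mod_cast m.factorial_ne_zero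
  have h2 : (eval (-1) ((X - 1 : ℝ[X]) ^ m)) ^ 2 = (2 ^ m) ^ 2 := by
    simp
    rw [pow_right_comm (-1 - 1 : ℝ), pow_right_comm (2 : ℝ) m 2]
    norm_num
  rw [mul_pow, mul_pow, h2]
  field_simp

lemma pint (p q : ℝ[X]) (a b : ℝ) :
    IntervalIntegrable (fun x => p.eval x * q.eval x) volume a b :=
  Continuous.intervalIntegrable (by fun_prop) _ _

lemma poly_parts (p q : ℝ[X]) (a b : ℝ) :
    ∫ x in a..b, (derivative p).eval x * q.eval x
      = p.eval b * q.eval b - p.eval a * q.eval a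
        - ∫ x in a..b, p.eval x * (derivative q).eval x := by
  rw [intervalIntegral.integral_mul_deriv_eq_deriv_mul (u := fun x => p.eval x)
    (v := fun x => q.eval x) (u' := fun x => (derivative p).eval x)
    (fun x _ => p.hasDerivAt x) (fun x _ => q.hasDerivAt x)
    (Continuous.intervalIntegrable (by fun_prop) _ _)
    (Continuous.intervalIntegrable (by fun_prop) _ _)]
  ring

lemma degree_deriv_lt {q : ℝ[X]} {n : ℕ} (h : q.degree < (n + 1 : ℕ)) :
    (derivative q).degree < (n : ℕ) := by
  rw [degree_lt_iff_coeff_zero] at *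
  intro i hi
  rw [coeff_derivative, h (i+1) (by omega), zero_mul]

lemma orth0 (m n : ℕ) (hn : n ≤ m) : ∀ q : ℝ[X], q.degree < n →
    ∫ x in (-1:ℝ)..1, (derivative^[n] (((X : ℝ[X]) ^ 2 - 1) ^ m)).eval x * q.eval x = 0 := by
  induction n with
  | zero =>
    intro q hq
    have : q = 0 := by
      rw [← degree_eq_bot]; simpa using hq
    simp [this]
  | succ n ih =>
    intro q hq
    rw [Function.iterate_succ_apply', poly_parts, bd1 (by omega), bd2 (by omega),
      ih (by omega) _ (degree_deriv_lt hq)]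
    simp

lemma Lp_orth (m : ℕ) (q : ℝ[X]) (hq : q.degree < m) :
    ∫ x in (-1:ℝ)..1, (LegP m).eval x * q.eval x = 0 := by
  simp only [LegP, eval_mul, eval_C, mul_assoc]
  rw [intervalIntegral.integral_const_mul, orth0 m m le_rfl q hq, mul_zero]

lemma Lp_natDegree (m : ℕ) : (LegP m).natDegree = m := by
  have hm : (((X : ℝ[X]) ^ 2 - 1) ^ m).natDegree = 2 * m := by
    have : ((X : ℝ[X]) ^ 2 - 1).natDegree = 2 := natDegree_X_pow_sub_C (n := 2) (r := (1:ℝ))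
    rw [natDegree_pow, this, mul_comm]
  have hmon : (((X : ℝ[X]) ^ 2 - 1) ^ m).Monic :=
    (monic_X_pow_sub_C (1:ℝ) (two_ne_zero)).pow m
  have hf : (m.factorial : ℝ) ≠ 0 := by exact_mod_cast m.factorial_ne_zero
  rw [LegP, natDegree_C_mul (by positivity)]
  apply natDegree_eq_of_le_of_coeff_ne_zero
  · refine (natDegree_iterate_derivative _ _).trans ?_
    omega
  · rw [coeff_iterate_derivative]
    have : (((X : ℝ[X]) ^ 2 - 1) ^ m).coeff (m + m) = 1 := by
      rw [← two_mul, ← hm]; exact hmon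
    rw [this, nsmul_eq_mul, mul_one]
    exact_mod_cast (Nat.descFactorial_pos.2 (by omega)).ne'

/-- Cell Legendre polynomial. -/
noncomputable def Lc (a b : ℝ) (m : ℕ) : ℝ[X] :=
  (LegP m).comp (C (2 / (b - a)) * X + C (-(a + b) / (b - a)))

lemma legendreCell_eq (m : ℕ) (a b x : ℝ) : legendreCell m a b x = (Lc a b m).eval x := by
  rw [legendreCell, legendreP_eq, Lc, eval_comp]
  congr 1
  simp; ring

lemma Lc_b {a b : ℝ} (h : a < b) (m : ℕ) : (Lc a b m).eval b = 1 := by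
  have : b - a ≠ 0 := by linarith
  rw [Lc, eval_comp, ← Lp_one m]
  congr 1
  simp; field_simp; ring

lemma Lc_a {a b : ℝ} (h : a < b) (m : ℕ) : (Lc a b m).eval a ^ 2 = 1 := by
  have : b - a ≠ 0 := by linarith
  rw [Lc, eval_comp, ← Lp_neg_one m]
  congr 2
  simp; field_simp; ring

lemma Lc_natDegree {a b : ℝ} (h : a < b) (m : ℕ) : (Lc a b m).natDegree = m := by
  have : b - a ≠ 0 := by linarith
  rw [Lc, natDegree_comp, Lp_natDegree, natDegree_linear (by positivity), mul_one]

lemma Lc_coeff {a b : ℝ} (h : a < b) (m : ℕ) : (Lc a b m).coeff m ≠ 0 := by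
  have h0 : Lc a b m ≠ 0 := by
    intro h0; have := Lc_b h m; simp [h0] at this
  have := leadingCoeff_ne_zero.2 h0
  rwa [leadingCoeff, Lc_natDegree h] at this

lemma Lc_orth {a b : ℝ} (h : a < b) (m : ℕ) (q : ℝ[X]) (hq : q.degree < m) :
    ∫ x in a..b, (Lc a b m).eval x * q.eval x = 0 := by
  have hh : b - a ≠ 0 := by linarith
  by_cases hq0 : q = 0
  · simp [hq0]
  set q' := q.comp (C ((b - a) / 2) * X + C ((a + b) / 2)) with hq'
  have h1 : ∀ x, (Lc a b m).eval x * q.eval x =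
      (fun y => (LegP m).eval y * q'.eval y) (2 / (b - a) * x + (-(a + b) / (b - a))) := by
    intro x
    simp only [Lc, hq', eval_comp, eval_add, eval_mul, eval_C, eval_X]
    congr 2
    field_simp; ring
  rw [intervalIntegral.integral_congr (fun x _ => h1 x)]
  rw [intervalIntegral.integral_comp_mul_add (fun y => (LegP m).eval y * q'.eval y) (by positivity)]
  have e1 : 2 / (b - a) * a + (-(a + b) / (b - a)) = -1 := by field_simp; ring
  have e2 : 2 / (b - a) * b + (-(a + b) / (b - a)) = 1 := by field_simp; ring
  rw [e1, e2, Lp_orth, smul_zero]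
  have hm : q.natDegree < m := (natDegree_lt_iff_degree_lt hq0).2 hq
  refine lt_of_le_of_lt degree_le_natDegree ?_
  rw [hq', natDegree_comp, natDegree_linear (div_ne_zero hh two_ne_zero), mul_one]
  exact_mod_cast hm

lemma Lc_norm {a b : ℝ} (h : a < b) (m : ℕ) :
    (2 * (m:ℝ) + 1) / (b - a) * ∫ x in a..b, (Lc a b m).eval x * (Lc a b m).eval x = 1 := by
  have hh : b - a ≠ 0 := by linarith
  set L := Lc a b m with hL
  set N := ∫ x in a..b, L.eval x * L.eval x with hN
  set r : ℝ[X] := (X - C ((a + b) / 2)) * derivative L - C (m:ℝ) * L with hr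
  have hrd : r.degree < m := by
    rw [degree_lt_iff_coeff_zero]
    intro i hi
    have hc : ∀ i, m < i → L.coeff i = 0 := fun i hi =>
      coeff_eq_zero_of_natDegree_lt (by rw [hL, Lc_natDegree h]; exact hi)
    have e : r.coeff i = i * L.coeff i - (a + b) / 2 * (L.coeff (i + 1) * (i + 1))
        - m * L.coeff i := by
      rw [hr, sub_mul]
      simp only [coeff_sub, coeff_C_mul, coeff_derivative]
      cases i with
      | zero => simp
      | succ i => rw [coeff_X_mul, coeff_derivative]; push_cast; ring
    rw [e, hc (i+1) (by omega)]
    rcases Nat.eq_or_lt_of_le hi with h' | h'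
    · rw [← h']; ring
    · rw [hc i h']; ring
  have o := Lc_orth h m r hrd
  have e1 : ∫ x in a..b, (Lc a b m).eval x * r.eval x =
      (∫ x in a..b, (derivative L).eval x * ((X - C ((a + b) / 2)) * L).eval x) - m * N := by
    rw [hN, ← intervalIntegral.integral_const_mul, ← intervalIntegral.integral_sub (pint _ _ _ _)
      (Continuous.intervalIntegrable (by fun_prop) _ _)]
    congr 1; funext x; simp [hr, ← hL]; ring
  have e2 := poly_parts L ((X - C ((a + b) / 2)) * L) a b
  have e3 : ∫ x in a..b, L.eval x * (derivative ((X - C ((a + b) / 2)) * L)).eval x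
      = N + ∫ x in a..b, (derivative L).eval x * ((X - C ((a + b) / 2)) * L).eval x := by
    rw [hN, ← intervalIntegral.integral_add (pint _ _ _ _) (pint _ _ _ _)]
    congr 1; funext x; simp; ring
  have e4 : L.eval b = 1 := Lc_b h m
  have e5 : L.eval a ^ 2 = 1 := Lc_a h m
  rw [e3] at e2
  simp only [eval_mul, eval_sub, eval_X, eval_C, e4] at e2
  rw [o] at e1
  simp only [eval_mul, eval_sub, eval_X, eval_C] at e1
  have e6 : eval a L * ((a - (a + b) / 2) * eval a L) = (a - (a+b)/2) := by
    linear_combination (a - (a+b)/2) * e5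
  rw [e6] at e2
  field_simp
  linarith

lemma Lc_expand {a b : ℝ} (h : a < b) (n : ℕ) : ∀ p : ℝ[X], p.degree < n → ∀ y,
    p.eval y = ∑ i ∈ Finset.range n, (2 * (i:ℝ) + 1) / (b - a)
      * (∫ x in a..b, p.eval x * (Lc a b i).eval x) * (Lc a b i).eval y := by
  induction n with
  | zero =>
    intro p hq y
    have : p = 0 := by
      rw [← degree_eq_bot]; simpa using hq
    simp [this]
  | succ n ih =>
    intro p hp y
    set c := p.coeff n / (Lc a b n).coeff n with hc
    set q := p - C c * Lc a b n with hq
    have hqd : q.degree < n := by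
      rw [degree_lt_iff_coeff_zero] at hp ⊢
      intro i hi
      rw [hq, coeff_sub, coeff_C_mul]
      rcases Nat.eq_or_lt_of_le hi with h' | h'
      · rw [← h', hc, div_mul_cancel₀ _ (Lc_coeff h n), sub_self]
      · rw [hp i h', coeff_eq_zero_of_natDegree_lt (by rw [Lc_natDegree h]; exact h')]; simp
    have hpq : p = q + C c * Lc a b n := by rw [hq]; ring
    have key : ∀ i, ∫ x in a..b, p.eval x * (Lc a b i).eval x
        = (∫ x in a..b, q.eval x * (Lc a b i).eval x)
          + c * ∫ x in a..b, (Lc a b n).eval x * (Lc a b i).eval x := by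
      intro i
      rw [← intervalIntegral.integral_const_mul, ← intervalIntegral.integral_add (pint _ _ _ _)
        (Continuous.intervalIntegrable (by fun_prop) _ _)]
      congr 1; funext x; rw [hpq]; simp; ring
    rw [Finset.sum_range_succ]
    have h1 : ∀ i ∈ Finset.range n, (2 * (i:ℝ) + 1) / (b - a)
      * (∫ x in a..b, p.eval x * (Lc a b i).eval x) * (Lc a b i).eval y = 
       (2 * (i:ℝ) + 1) / (b - a)
      * (∫ x in a..b, q.eval x * (Lc a b i).eval x) * (Lc a b i).eval y := by
      intro i hi
      have hi' : i < n := Finset.mem_range.1 hi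
      rw [key, Lc_orth h n (Lc a b i), mul_zero, add_zero]
      refine lt_of_le_of_lt degree_le_natDegree ?_
      rw [Lc_natDegree h]; exact_mod_cast hi'
    rw [Finset.sum_congr rfl h1, ← ih q hqd y, key]
    have h2 : ∫ x in a..b, q.eval x * (Lc a b n).eval x = 0 := by
      rw [← Lc_orth h n q hqd]; congr 1; funext x; ring
    rw [h2, hpq]
    simp only [eval_add, eval_mul, eval_C]
    linear_combination -(c * eval y (Lc a b n)) * Lc_norm h n

/-- Explicit Gauss–Radau projection. -/
noncomputable def GRP (k : ℕ) (a b : ℝ) (w : ℝ → ℝ) (y : ℝ) : ℝ :=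
  ∑ i ∈ Finset.range k, (2 * (i:ℝ) + 1) / (b - a)
      * (∫ x in a..b, w x * (Lc a b i).eval x) * (Lc a b i).eval y
  + (w b - ∑ i ∈ Finset.range k, (2 * (i:ℝ) + 1) / (b - a)
      * (∫ x in a..b, w x * (Lc a b i).eval x)) * (Lc a b k).eval y

lemma degree_lt_of_nat {p : ℝ[X]} {k : ℕ} (h : p.natDegree ≤ k) : p.degree < (k + 1 : ℕ) :=
  lt_of_le_of_lt degree_le_natDegree (by exact_mod_cast Nat.lt_succ_of_le h)

lemma GRP_unique {k : ℕ} {a b : ℝ} (h : a < b) {w : ℝ → ℝ} {P : ℝ[X]}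
    (hP : IsGRProj k a b w P) (y : ℝ) : P.eval y = GRP k a b w y := by
  obtain ⟨hd, ho, hb⟩ := hP
  have e := Lc_expand h (k + 1) P (degree_lt_of_nat hd)
  have hi : ∀ i ∈ Finset.range k, ∫ x in a..b, P.eval x * (Lc a b i).eval x
      = ∫ x in a..b, w x * (Lc a b i).eval x := by
    intro i hi
    apply ho
    rw [Lc_natDegree h]
    exact Finset.mem_range.1 hi
  have e' : ∀ y, P.eval y = ∑ i ∈ Finset.range k, (2 * (i:ℝ) + 1) / (b - a)
      * (∫ x in a..b, w x * (Lc a b i).eval x) * (Lc a b i).eval y +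
      (2 * (k:ℝ) + 1) / (b - a) * (∫ x in a..b, P.eval x * (Lc a b k).eval x)
        * (Lc a b k).eval y := by
    intro y
    rw [e y, Finset.sum_range_succ]
    congr 1
    apply Finset.sum_congr rfl
    intro i hi'
    rw [hi i hi']
  have eb := e' b
  simp only [Lc_b h, mul_one] at eb
  rw [GRP, e' y, ← hb, eb]
  ring

/-- The kernel polynomial in the Radau coefficient. -/
noncomputable def Kp (a b : ℝ) (m : ℕ) : ℝ[X] :=
  ∑ i ∈ Finset.range m, C (2 * (i:ℝ) + 1) * Lc a b i

lemma radau_eq (a b : ℝ) (w : ℝ → ℝ) (m : ℕ) :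
    radauCoeff a b w m = w b - (1 / (b - a)) * ∫ x in a..b, w x * (Kp a b m).eval x := by
  simp only [radauCoeff, Kp, legendreCell_eq, eval_finsetSum, eval_mul, eval_C]

lemma radau_sum (a b : ℝ) {w : ℝ → ℝ} (hw : Continuous w) (m : ℕ) :
    radauCoeff a b w m = w b - ∑ i ∈ Finset.range m, (2 * (i:ℝ) + 1) / (b - a)
      * ∫ x in a..b, w x * (Lc a b i).eval x := by
  simp only [radauCoeff, legendreCell_eq, Finset.mul_sum]
  rw [intervalIntegral.integral_finsetSum
    (fun i _ => Continuous.intervalIntegrable (by fun_prop) _ _), Finset.mul_sum]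
  congr 1
  apply Finset.sum_congr rfl
  intro i _
  rw [← intervalIntegral.integral_const_mul, ← intervalIntegral.integral_const_mul]
  congr 1; funext x; ring

lemma GRP_continuous (k : ℕ) (a b : ℝ) (w : ℝ → ℝ) : Continuous (GRP k a b w) := by
  unfold GRP; fun_prop

lemma GRP_pair {k : ℕ} {a b : ℝ} (h : a < b) {w : ℝ → ℝ} (hw : Continuous w)
    {v : ℝ[X]} (hv : v.natDegree ≤ k) :
    ∫ x in a..b, (w x - GRP k a b w x) * v.eval x
      = - radauCoeff a b w (k+1) * ∫ x in a..b, (Lc a b k).eval x * v.eval x := by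
  set A : ℕ → ℝ := fun i => ∫ x in a..b, w x * (Lc a b i).eval x with hA
  set B : ℕ → ℝ := fun i => ∫ x in a..b, v.eval x * (Lc a b i).eval x with hB
  have e := Lc_expand h (k + 1) v (degree_lt_of_nat hv)
  have h1 : ∫ x in a..b, w x * v.eval x
      = ∑ i ∈ Finset.range (k+1), (2 * (i:ℝ) + 1) / (b - a) * B i * A i := by
    have : ∀ x, w x * v.eval x = ∑ i ∈ Finset.range (k+1),
        (2 * (i:ℝ) + 1) / (b - a) * B i * (w x * (Lc a b i).eval x) := by
      intro x
      rw [e x, Finset.mul_sum]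
      apply Finset.sum_congr rfl
      intro i _
      simp only [hB]; ring
    simp_rw [this]
    rw [intervalIntegral.integral_finsetSum
      (fun i _ => Continuous.intervalIntegrable (by fun_prop) _ _)]
    simp_rw [intervalIntegral.integral_const_mul]
    rfl
  have h2 : ∀ x, GRP k a b w x = ∑ i ∈ Finset.range (k+1),
      (2 * (i:ℝ) + 1) / (b - a) * A i * (Lc a b i).eval x
      + radauCoeff a b w (k+1) * (Lc a b k).eval x := by
    intro x
    rw [radau_sum a b hw, GRP, Finset.sum_range_succ, Finset.sum_range_succ]
    ring
  have h3 : ∫ x in a..b, GRP k a b w x * v.eval x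
      = ∑ i ∈ Finset.range (k+1), (2 * (i:ℝ) + 1) / (b - a) * A i * B i
        + radauCoeff a b w (k+1) * ∫ x in a..b, (Lc a b k).eval x * v.eval x := by
    have : ∀ x, GRP k a b w x * v.eval x = ∑ i ∈ Finset.range (k+1),
        (2 * (i:ℝ) + 1) / (b - a) * A i * (v.eval x * (Lc a b i).eval x)
        + radauCoeff a b w (k+1) * ((Lc a b k).eval x * v.eval x) := by
      intro x
      rw [h2, add_mul, Finset.sum_mul]
      congr 1
      · apply Finset.sum_congr rfl
        intro i _; ring
      · ring
    simp_rw [this]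
    rw [intervalIntegral.integral_add (Continuous.intervalIntegrable (by fun_prop) _ _)
      (Continuous.intervalIntegrable (by fun_prop) _ _), intervalIntegral.integral_finsetSum
      (fun i _ => Continuous.intervalIntegrable (by fun_prop) _ _)]
    simp_rw [intervalIntegral.integral_const_mul]
    rfl
  have hc := GRP_continuous k a b w
  simp_rw [sub_mul]
  rw [intervalIntegral.integral_sub (Continuous.intervalIntegrable (by fun_prop) _ _)
      (Continuous.intervalIntegrable (by fun_prop) _ _), h1, h3]
  have : ∑ i ∈ Finset.range (k+1), (2 * (i:ℝ) + 1) / (b - a) * B i * A i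
    = ∑ i ∈ Finset.range (k+1), (2 * (i:ℝ) + 1) / (b - a) * A i * B i :=
    Finset.sum_congr rfl (fun i _ => by ring)
  rw [this]; ring

lemma shift_deriv {f : ℝ → ℝ} (hf : ContDiff ℝ 1 f) (y t : ℝ) :
    HasDerivAt (fun s => f (y - s)) (-deriv f (y - t)) t := by
  have h1 : HasDerivAt f (deriv f (y - t)) (y - t) :=
    ((hf.differentiable one_ne_zero) _).hasDerivAt
  have h2 : HasDerivAt (fun s => y - s) (-1) t := by
    simpa using (hasDerivAt_id t).const_sub y
  have h3 := h1.comp t h2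
  rw [mul_neg_one] at h3
  exact h3

lemma par_deriv {f : ℝ → ℝ} (hf : ContDiff ℝ 1 f) (q : ℝ[X]) (a b t : ℝ) :
    HasDerivAt (fun s => ∫ y in a..b, f (y - s) * q.eval y)
      (∫ y in a..b, -deriv f (y - t) * q.eval y) t := by
  have hd : Continuous (deriv f) := hf.continuous_deriv le_rfl
  have hfc : Continuous f := hf.continuous
  have hK : IsCompact (Set.Icc (t-1) (t+1) ×ˢ Set.uIcc a b) := isCompact_Icc.prod isCompact_uIcc
  obtain ⟨M, hM⟩ := hK.exists_bound_of_continuousOn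
    (f := fun p : ℝ × ℝ => -deriv f (p.2 - p.1) * q.eval p.2)
    (Continuous.continuousOn (by fun_prop))
  refine (intervalIntegral.hasDerivAt_integral_of_dominated_loc_of_deriv_le
    (F := fun s y => f (y - s) * q.eval y) (F' := fun s y => -deriv f (y - s) * q.eval y)
    (s := Set.Icc (t-1) (t+1)) (bound := fun _ => M)
    (Icc_mem_nhds (by linarith) (by linarith)) ?_ ?_ ?_ ?_ ?_ ?_).2
  · exact Filter.Eventually.of_forall fun s =>
      (Continuous.aestronglyMeasurable (by fun_prop))
  · exact Continuous.intervalIntegrable (by fun_prop) _ _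
  · exact Continuous.aestronglyMeasurable (by fun_prop)
  · exact Filter.Eventually.of_forall fun y hy s hs =>
      hM (s, y) ⟨hs, Set.uIoc_subset_uIcc hy⟩
  · exact Continuous.intervalIntegrable (by fun_prop) _ _
  · exact Filter.Eventually.of_forall fun y hy s hs => (shift_deriv hf y s).mul_const _

lemma GRP_deriv {f : ℝ → ℝ} (hf : ContDiff ℝ 1 f) (k : ℕ) (a b y t : ℝ) :
    HasDerivAt (fun s => GRP k a b (fun z => f (z - s)) y)
      (GRP k a b (fun z => -deriv f (z - t)) y) t := by
  unfold GRP
  refine HasDerivAt.add ?_ ?_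
  · refine HasDerivAt.fun_sum fun i _ => ?_
    exact ((par_deriv hf _ a b t).const_mul _).mul_const _
  · refine HasDerivAt.mul_const (HasDerivAt.sub (shift_deriv hf b t) ?_) _
    refine HasDerivAt.fun_sum fun i _ => ?_
    exact (par_deriv hf _ a b t).const_mul _

lemma radau_deriv {f : ℝ → ℝ} (hf : ContDiff ℝ 1 f) (m : ℕ) (a b t : ℝ) :
    HasDerivAt (fun s => radauCoeff a b (fun z => f (z - s)) m)
      (radauCoeff a b (fun z => -deriv f (z - t)) m) t := by
  simp only [radau_eq]
  exact (shift_deriv hf b t).sub ((par_deriv hf _ a b t).const_mul _)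

lemma radau_contDiff (n m : ℕ) (a b : ℝ) : ∀ f : ℝ → ℝ, ContDiff ℝ n f →
    ContDiff ℝ n (fun s => radauCoeff a b (fun z => f (z - s)) m) := by
  induction n with
  | zero =>
    intro f hf
    simp only [CharP.cast_eq_zero, contDiff_zero] at hf ⊢
    simp only [radau_eq]
    have : Continuous fun s => ∫ x in a..b, f (x - s) * (Kp a b m).eval x :=
      intervalIntegral.continuous_parametric_intervalIntegral_of_continuous' (by fun_prop) _ _
    fun_prop
  | succ n ih =>
    intro f hf
    have hf1 : ContDiff ℝ 1 f := hf.of_le (by exact_mod_cast Nat.le_add_left 1 n)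
    have hd : deriv (fun s => radauCoeff a b (fun z => f (z - s)) m)
        = fun s => radauCoeff a b (fun z => (fun y => -deriv f y) (z - s)) m := by
      funext t; exact (radau_deriv hf1 m a b t).deriv
    push_cast at hf ⊢
    rw [contDiff_succ_iff_deriv] at hf ⊢
    refine ⟨fun t => (radau_deriv hf1 m a b t).differentiableAt, by simp, ?_⟩
    rw [hd]
    exact ih _ hf.2.2.neg

lemma Gfun_deriv {f : ℝ → ℝ} {n : ℕ} (hf : ContDiff ℝ n f) (k : ℕ) (a b : ℝ) {i : ℕ}
    (hi : i < n) (t : ℝ) :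
    HasDerivAt (Gfun k a b f i) (Gfun k a b f (i+1) t) t := by
  have h := radau_contDiff n (k+1) a b f hf
  have := h.differentiable_iteratedDeriv i (by exact_mod_cast hi)
  have e : Gfun k a b f (i+1) t = deriv (Gfun k a b f i) t := by
    show iteratedDeriv (i+1) _ t = _
    rw [iteratedDeriv_succ]
    rfl
  rw [e]
  exact (this t).hasDerivAt

lemma Gfun_one {f : ℝ → ℝ} (hf : ContDiff ℝ 1 f) (k : ℕ) (a b t : ℝ) :
    Gfun k a b f 1 t = radauCoeff a b (fun z => -deriv f (z - t)) (k+1) := by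
  rw [Gfun, iteratedDeriv_one]
  exact (radau_deriv hf (k+1) a b t).deriv

lemma Dinv_parts {a b : ℝ} {f : ℝ → ℝ} (hf : Continuous f) (v : ℝ[X]) :
    ∫ x in a..b, Dinv a b f x * (derivative v).eval x
      = Dinv a b f b * v.eval b - 2 / (b - a) * ∫ x in a..b, f x * v.eval x := by
  have h := intervalIntegral.integral_mul_deriv_eq_deriv_mul (a := a) (b := b)
    (u := Dinv a b f) (u' := fun x => 2 / (b - a) * f x)
    (v := fun x => v.eval x) (v' := fun x => (derivative v).eval x)
    (fun x _ => by
      unfold Dinv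
      exact (hf.integral_hasStrictDerivAt a x).hasDerivAt.const_mul _)
    (fun x _ => v.hasDerivAt x)
    (Continuous.intervalIntegrable (by fun_prop) _ _)
    (Continuous.intervalIntegrable (by fun_prop) _ _)
  rw [h, ← intervalIntegral.integral_const_mul]
  have : Dinv a b f a = 0 := by simp [Dinv]
  rw [this]
  simp [mul_assoc]

lemma exists_antideriv (v : ℝ[X]) : ∃ V : ℝ[X], derivative V = v ∧
    V.natDegree ≤ v.natDegree + 1 := by
  refine ⟨∑ i ∈ Finset.range (v.natDegree + 1), monomial (i+1) (v.coeff i / (i + 1)), ?_, ?_⟩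
  · conv_rhs => rw [v.as_sum_range]
    rw [derivative_sum]
    apply Finset.sum_congr rfl
    intro i _
    rw [derivative_monomial]
    have : (i:ℝ) + 1 ≠ 0 := by positivity
    simp [div_mul_cancel₀ _ this]
  · apply natDegree_sum_le_of_forall_le
    intro i hi
    refine (natDegree_monomial_le _).trans ?_
    have := Finset.mem_range.1 hi
    omega

section cell
variable {k : ℕ} {a b : ℝ} {F : ℕ → ℝ[X]}

lemma deriv_deg (hk : 1 ≤ k) {v : ℝ[X]} (hv : v.natDegree ≤ k) :
    (derivative v).natDegree + 1 ≤ k := by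
  have := natDegree_derivative_le v
  omega

lemma Fb_one (h : a < b) (hk : 1 ≤ k) (hF : IsFSeq k a b F) : (F 1).eval b = 0 := by
  rw [hF.1.2.2, Dinv]
  have := Lc_orth h k 1 (by rw [degree_one]; exact_mod_cast hk)
  simp only [eval_one, mul_one] at this
  simp only [legendreCell_eq, this, mul_zero]

lemma F_one_parts (h : a < b) (hk : 1 ≤ k) (hF : IsFSeq k a b F) (v : ℝ[X])
    (hv : v.natDegree ≤ k) :
    ∫ x in a..b, (F 1).eval x * (derivative v).eval x
      = - (2 / (b - a)) * ∫ x in a..b, (Lc a b k).eval x * v.eval x := by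
  have hL : legendreCell k a b = fun x => (Lc a b k).eval x := by
    funext x; exact legendreCell_eq k a b x
  rw [hF.1.2.1 _ (deriv_deg hk hv), Dinv_parts (by rw [hL]; fun_prop), ← hF.1.2.2,
    Fb_one h hk hF, hL]
  ring

lemma F_succ_parts (hk : 1 ≤ k) (hF : IsFSeq k a b F) {i : ℕ} (hi : 1 ≤ i) (v : ℝ[X])
    (hv : v.natDegree ≤ k) :
    ∫ x in a..b, (F (i+1)).eval x * (derivative v).eval x
      = (F (i+1)).eval b * v.eval b + (2 / (b - a)) * ∫ x in a..b, (F i).eval x * v.eval x := by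
  obtain ⟨h1, h2, h3⟩ := hF.2 (i+1) (by omega)
  have := h2 _ (deriv_deg hk hv)
  simp only [Nat.add_sub_cancel] at this h3
  rw [Dinv_parts (by fun_prop), ← h3] at this
  simp only [eval_neg, neg_mul, intervalIntegral.integral_neg] at this
  linarith

lemma F_succ_b (hF : IsFSeq k a b F) {i : ℕ} (hi : 1 ≤ i) :
    (F (i+1)).eval b = - (2 / (b - a) * ∫ x in a..b, (F i).eval x) := by
  obtain ⟨h1, h2, h3⟩ := hF.2 (i+1) (by omega)
  simp only [Nat.add_sub_cancel, Dinv, eval_neg] at h3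
  linarith

lemma F_orth (h : a < b) (hk : 1 ≤ k) (hF : IsFSeq k a b F) (i : ℕ) (hi : 1 ≤ i) :
    ∀ q : ℝ[X], q.natDegree + i + 1 ≤ k → ∫ x in a..b, (F i).eval x * q.eval x = 0 := by
  induction i, hi using Nat.le_induction with
  | base =>
    intro q hq
    obtain ⟨V, rfl, hV⟩ := exists_antideriv q
    rw [F_one_parts h hk hF V (by omega), Lc_orth h k V, mul_zero]
    refine lt_of_le_of_lt degree_le_natDegree ?_
    have : V.natDegree < k := by omega
    exact_mod_cast this
  | succ i hi ih =>
    intro q hq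
    obtain ⟨V, rfl, hV⟩ := exists_antideriv q
    rw [F_succ_parts hk hF hi V (by omega), F_succ_b hF hi, ih V (by omega)]
    have := ih 1 (by simp; omega)
    simp only [eval_one, mul_one] at this
    rw [this]; simp

lemma Fb (h : a < b) (hk : 1 ≤ k) (hF : IsFSeq k a b F) {i : ℕ} (hi : 1 ≤ i) (hik : i ≤ k) :
    (F i).eval b = 0 := by
  rcases Nat.eq_or_lt_of_le hi with h' | h'
  · rw [← h']; exact Fb_one h hk hF
  · obtain ⟨i, rfl⟩ : ∃ n, i = n + 1 := ⟨i - 1, by omega⟩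
    rw [F_succ_b hF (by omega)]
    have := F_orth h hk hF i (by omega) 1 (by simp; omega)
    simp only [eval_one, mul_one] at this
    rw [this]; simp

lemma cell_trace (h : a < b) (hk : 1 ≤ k) (hF : IsFSeq k a b F) {l : ℕ} (hl : l ≤ k)
    {u0 : ℝ → ℝ} {P : ℝ → ℝ[X]} (t : ℝ) (hP : IsGRProj k a b (fun y => u0 (y - t)) (P t)) :
    u0 (b - t) - uIl k a b u0 P F l b t = 0 := by
  have : wSum k a b u0 F l b t = 0 := by
    apply Finset.sum_eq_zero
    intro i hi
    rw [Finset.mem_Icc] at hi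
    rw [wFun, Fb h hk hF hi.1 (hi.2.trans hl), mul_zero]
  rw [uIl, this, hP.2.2]
  ring

lemma telescope (c d M : ℝ) (hcd : c * d = 1) (G J K : ℕ → ℝ) (l : ℕ) (hl : 1 ≤ l)
    (hK1 : K 1 = - d * M) (hK : ∀ i, 1 ≤ i → i < l → K (i+1) = d * J i) :
    -G 1 * M + ∑ i ∈ Finset.Icc 1 l, c ^ i * G (i+1) * J i
      - ∑ i ∈ Finset.Icc 1 l, c ^ i * G i * K i = c ^ l * G (l+1) * J l := by
  induction l, hl using Nat.le_induction with
  | base =>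
    simp [hK1]
    linear_combination G 1 * M * hcd
  | succ l hl ih =>
    have := ih (fun i h1 h2 => hK i h1 (by omega))
    rw [Finset.sum_Icc_succ_top (by omega), Finset.sum_Icc_succ_top (by omega),
      hK l hl (by omega)]
    rw [pow_succ]
    linear_combination this - c ^ l * G (l+1) * J l * hcd

lemma cell_main (h : a < b) (hk : 1 ≤ k) (hF : IsFSeq k a b F) {l : ℕ} (hl1 : 1 ≤ l)
    (hl : l ≤ k) {u0 : ℝ → ℝ} {n : ℕ} (hn : l < n) (hu : ContDiff ℝ n u0) {P : ℝ → ℝ[X]}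
    (hP : ∀ t, IsGRProj k a b (fun y => u0 (y - t)) (P t)) (t : ℝ) (v : ℝ[X])
    (hv : v.natDegree ≤ k) :
    (∫ y in a..b, deriv (fun s => u0 (y - s) - uIl k a b u0 P F l y s) t * v.eval y)
      - (∫ y in a..b, (u0 (y - t) - uIl k a b u0 P F l y t) * (derivative v).eval y)
    = ((b - a) / 2) ^ l * Gfun k a b u0 (l+1) t * ∫ y in a..b, (F l).eval y * v.eval y := by
  have hh : b - a ≠ 0 := by linarith
  have hu1 : ContDiff ℝ 1 u0 := hu.of_le (by exact_mod_cast (by omega : 1 ≤ n))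
  have huc : Continuous u0 := hu.continuous
  have hdc : Continuous (deriv u0) := hu1.continuous_deriv le_rfl
  set w : ℝ → ℝ := fun z => -deriv u0 (z - t) with hw
  have hwc : Continuous w := by rw [hw]; fun_prop
  have hgc := GRP_continuous k a b w
  have hder : ∀ y, deriv (fun s => u0 (y - s) - uIl k a b u0 P F l y s) t
      = (w y - GRP k a b w y) + ∑ i ∈ Finset.Icc 1 l,
          ((b - a) / 2) ^ i * Gfun k a b u0 (i+1) t * (F i).eval y := by
    intro y
    apply HasDerivAt.deriv
    have hfun : (fun s => u0 (y - s) - uIl k a b u0 P F l y s) = fun s =>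
        (u0 (y - s) - GRP k a b (fun z => u0 (z - s)) y) + ∑ i ∈ Finset.Icc 1 l,
          ((b - a) / 2) ^ i * Gfun k a b u0 i s * (F i).eval y := by
      funext s
      rw [uIl, GRP_unique h (hP s) y]
      simp only [wSum, wFun]
      ring
    rw [hfun]
    refine ((shift_deriv hu1 y t).sub (GRP_deriv hu1 k a b y t)).add ?_
    refine HasDerivAt.fun_sum fun i hi => ?_
    rw [Finset.mem_Icc] at hi
    exact ((Gfun_deriv hu k a b (by omega) t).const_mul _).mul_const _
  have I1 : (∫ y in a..b, deriv (fun s => u0 (y - s) - uIl k a b u0 P F l y s) t * v.eval y)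
      = -Gfun k a b u0 1 t * (∫ x in a..b, (Lc a b k).eval x * v.eval x)
        + ∑ i ∈ Finset.Icc 1 l, ((b - a) / 2) ^ i * Gfun k a b u0 (i+1) t
          * ∫ x in a..b, (F i).eval x * v.eval x := by
    simp_rw [hder, add_mul]
    rw [intervalIntegral.integral_add (Continuous.intervalIntegrable (by fun_prop) _ _)
      (Continuous.intervalIntegrable (by fun_prop) _ _), GRP_pair h hwc hv, Gfun_one hu1]
    simp_rw [Finset.sum_mul, mul_assoc]
    rw [intervalIntegral.integral_finsetSum
      (fun i _ => Continuous.intervalIntegrable (by fun_prop) _ _)]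
    simp_rw [intervalIntegral.integral_const_mul]
    rfl
  have I2 : (∫ y in a..b, (u0 (y - t) - uIl k a b u0 P F l y t) * (derivative v).eval y)
      = ∑ i ∈ Finset.Icc 1 l, ((b - a) / 2) ^ i * Gfun k a b u0 i t
          * ∫ x in a..b, (F i).eval x * (derivative v).eval x := by
    have e : ∀ y, (u0 (y - t) - uIl k a b u0 P F l y t) * (derivative v).eval y
        = (u0 (y - t) * (derivative v).eval y - (P t).eval y * (derivative v).eval y)
          + ∑ i ∈ Finset.Icc 1 l, ((b - a) / 2) ^ i * Gfun k a b u0 i t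
            * ((F i).eval y * (derivative v).eval y) := by
      intro y
      simp only [uIl, wSum, wFun]
      simp_rw [← mul_assoc]
      rw [← Finset.sum_mul]
      ring
    simp_rw [e]
    rw [intervalIntegral.integral_add (Continuous.intervalIntegrable (by fun_prop) _ _)
      (Continuous.intervalIntegrable (by fun_prop) _ _),
      intervalIntegral.integral_sub (Continuous.intervalIntegrable (by fun_prop) _ _)
      (Continuous.intervalIntegrable (by fun_prop) _ _),
      (hP t).2.1 _ (deriv_deg hk hv), sub_self, zero_add, intervalIntegral.integral_finsetSum
      (fun i _ => Continuous.intervalIntegrable (by fun_prop) _ _)]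
    simp_rw [intervalIntegral.integral_const_mul]
  rw [I1, I2]
  refine telescope ((b - a) / 2) (2 / (b - a)) _ (by field_simp) (fun i => Gfun k a b u0 i t)
    (fun i => ∫ x in a..b, (F i).eval x * v.eval x)
    (fun i => ∫ x in a..b, (F i).eval x * (derivative v).eval x) l hl1
    (F_one_parts h hk hF v hv) ?_
  intro i h1 h2
  show ∫ x in a..b, (F (i+1)).eval x * (derivative v).eval x = _
  rw [F_succ_parts hk hF h1 v hv, Fb h hk hF (by omega) (by omega), zero_mul, zero_add]

end cell

end helpers

/-- `a_j(u - u_I^l, v) = (h_j/2)^l G_{l+1}(t) ∫_{τ_j} F_l v`, the trace of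
`u - u_I^l` at `x_{j-1/2}` from the left being taken from the cell `τ_{j-1}` for `j ≥ 2`
(where it equals `0`) and set equal to `0` for `j = 1`. -/
theorem stmt8 (k l : ℕ) (hk : 2 ≤ k) (hl1 : 1 ≤ l) (hlk : l ≤ k - 1)
    (N : ℕ) (x : ℕ → ℝ) (hN : 1 ≤ N) (hx0 : x 0 = 0) (hxN : x N = 2 * Real.pi)
    (hmono : ∀ j < N, x j < x (j+1))
    (u0 : ℝ → ℝ) (hu0 : ContDiff ℝ (k+l+2) u0)
    (P : ℕ → ℝ → Polynomial ℝ)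
    (hP : ∀ j ∈ Finset.Icc 1 N, ∀ t : ℝ,
      IsGRProj k (x (j-1)) (x j) (fun y => u0 (y - t)) (P j t))
    (F : ℕ → ℕ → Polynomial ℝ)
    (hF : ∀ j ∈ Finset.Icc 1 N, IsFSeq k (x (j-1)) (x j) (F j))
    (j : ℕ) (hj : j ∈ Finset.Icc 1 N) (t : ℝ)
    (v : Polynomial ℝ) (hv : v.natDegree ≤ k) :
    ((∀ j' ∈ Finset.Icc 2 N, errFun k l x u0 P F (j'-1) (x (j'-1)) t = 0)
      ∧ ((∫ y in (x (j-1))..(x j), deriv (fun s => errFun k l x u0 P F j y s) t * v.eval y)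
          - (∫ y in (x (j-1))..(x j), errFun k l x u0 P F j y t * v.derivative.eval y)
          + errFun k l x u0 P F j (x j) t * v.eval (x j)
          - (if j = 1 then 0 else errFun k l x u0 P F (j-1) (x (j-1)) t) * v.eval (x (j-1)))
        = ((x j - x (j-1)) / 2)^l * Gfun k (x (j-1)) (x j) u0 (l+1) t
            * ∫ y in (x (j-1))..(x j), (F j l).eval y * v.eval y) := by
  have hcell : ∀ i ∈ Finset.Icc 1 N, x (i-1) < x i := by
    intro i hi
    rw [Finset.mem_Icc] at hi
    have := hmono (i-1) (by omega)
    rwa [Nat.sub_add_cancel hi.1] at this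
  have htr : ∀ i ∈ Finset.Icc 1 N, errFun k l x u0 P F i (x i) t = 0 := by
    intro i hi
    exact cell_trace (hcell i hi) (by omega) (hF i hi) (by omega) t (hP i hi t)
  refine ⟨?_, ?_⟩
  · intro i hi
    rw [Finset.mem_Icc] at hi
    exact htr (i-1) (Finset.mem_Icc.2 ⟨by omega, by omega⟩)
  · have h0 : (if j = 1 then 0 else errFun k l x u0 P F (j-1) (x (j-1)) t) = 0 := by
      split_ifs with h1
      · rfl
      · rw [Finset.mem_Icc] at hj
        exact htr (j-1) (Finset.mem_Icc.2 ⟨by omega, by omega⟩)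
    rw [h0, htr j hj, zero_mul, zero_mul, add_zero, sub_zero]
    exact cell_main (hcell j hj) (by omega) (hF j hj) hl1 (by omega) (n := k + l + 2) (by omega)
      (by exact_mod_cast hu0) (hP j hj) t v hv
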